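/- Let λ > 0, μ > 0, β ≥ 0, and f ∈ (0,1], and let X and Y be independent random variables on a probability space with laws Exp(μ) and Exp(λ) respectively. Then E[(∫_{(1−f)·X}^{X} e^{−β·t} dt) · 1_{X<Y}] ≥ f·μ/(λ + μ + β)², and in particular this expectation is strictly positive and does not depend on any other system parameter. -/

import Mathlib

open MeasureTheory ProbabilityTheory Real

lemma expMeasure_eq_withDensity_restrict (r : ℝ) :
    expMeasure r = (volume.restrict (Set.Ioi 0)).withDensity
      (fun x => ENNReal.ofReal (r * exp (-(r * x)))) := by
  have h : exponentialPDF r =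
      (Set.Ici (0 : ℝ)).indicator (fun x => ENNReal.ofReal (r * exp (-(r * x)))) := by
    ext x
    by_cases hx : 0 ≤ x <;> simp [exponentialPDF_eq, Set.indicator, hx]
  change volume.withDensity (exponentialPDF r) = _
  rw [h, withDensity_indicator measurableSet_Ici,
    restrict_Ioi_eq_restrict_Ici]

lemma ae_expMeasure_pos (r : ℝ) : ∀ᵐ x ∂expMeasure r, 0 < x := by
  rw [expMeasure_eq_withDensity_restrict]
  exact (withDensity_absolutelyContinuous _ _).ae_le (ae_restrict_mem measurableSet_Ioi)

lemma integral_expMeasure {r : ℝ} (hr : 0 < r) (g : ℝ → ℝ) :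
    ∫ x, g x ∂expMeasure r = ∫ x in Set.Ioi 0, r * exp (-(r * x)) * g x := by
  rw [expMeasure_eq_withDensity_restrict,
    integral_withDensity_eq_integral_toReal_smul (by fun_prop) (by simp)]
  congr with x
  rw [ENNReal.toReal_ofReal (by positivity), smul_eq_mul]

lemma integrable_id_expMeasure {r : ℝ} (hr : 0 < r) :
    Integrable (fun x : ℝ => x) (expMeasure r) := by
  rw [expMeasure_eq_withDensity_restrict,
    integrable_withDensity_iff (by fun_prop) (by simp)]
  have h := (integrableOn_rpow_mul_exp_neg_mul_rpow (s := 1) (p := 1) (b := r)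
    (by norm_num) one_pos hr).const_mul r
  refine h.congr (ae_of_all _ fun x => ?_)
  simp only [rpow_one]
  rw [ENNReal.toReal_ofReal (by positivity), neg_mul]
  ring

lemma measureReal_expMeasure_Ioi {r x : ℝ} (hr : 0 < r) (hx : 0 ≤ x) :
    (expMeasure r).real (Set.Ioi x) = exp (-(r * x)) := by
  have := isProbabilityMeasure_expMeasure hr
  have h := cdf_expMeasure_eq hr x
  rw [if_pos hx, cdf_eq_real] at h
  rw [← Set.compl_Iic, probReal_compl_eq_one_sub measurableSet_Iic, h]
  ring

lemma continuous_integral_exp_window (β f : ℝ) :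
    Continuous fun x : ℝ => ∫ t in ((1 - f) * x)..x, exp (-β * t) := by
  have hi : ∀ a b : ℝ, IntervalIntegrable (fun t => exp (-β * t)) volume a b :=
    fun a b => (by fun_prop : Continuous fun t => exp (-β * t)).intervalIntegrable a b
  have hF := intervalIntegral.continuous_primitive hi 0
  have h : (fun x : ℝ => ∫ t in ((1 - f) * x)..x, exp (-β * t)) = fun x =>
      (∫ t in (0 : ℝ)..x, exp (-β * t)) - ∫ t in (0 : ℝ)..((1 - f) * x), exp (-β * t) := by
    ext x
    exact (intervalIntegral.integral_interval_sub_left (hi _ _) (hi _ _)).symm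
  rw [h]
  exact hF.sub (hF.comp (by fun_prop))

lemma le_integral_exp_window {β f x : ℝ} (hβ : 0 ≤ β) (hf : 0 ≤ f) (hx : 0 ≤ x) :
    f * x * exp (-β * x) ≤ ∫ t in ((1 - f) * x)..x, exp (-β * t) := by
  have hle : (1 - f) * x ≤ x := by nlinarith
  calc f * x * exp (-β * x) = ∫ _ in ((1 - f) * x)..x, exp (-β * x) := by
        rw [intervalIntegral.integral_const, smul_eq_mul]; ring
    _ ≤ _ := by
        refine intervalIntegral.integral_mono_on hle (by simp)
          ((by fun_prop : Continuous fun t => exp (-β * t)).intervalIntegrable _ _) fun t ht => ?_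
        exact exp_le_exp.2 (by nlinarith [ht.2])

lemma integral_exp_window_le {β f x : ℝ} (hβ : 0 ≤ β) (hf0 : 0 ≤ f) (hf1 : f ≤ 1)
    (hx : 0 ≤ x) : ∫ t in ((1 - f) * x)..x, exp (-β * t) ≤ f * x := by
  have hle : (1 - f) * x ≤ x := by nlinarith
  calc _ ≤ ∫ _ in ((1 - f) * x)..x, (1 : ℝ) := by
        refine intervalIntegral.integral_mono_on hle
          ((by fun_prop : Continuous fun t => exp (-β * t)).intervalIntegrable _ _)
          (by simp) fun t ht => ?_
        have : 0 ≤ t := (mul_nonneg (by linarith) hx).trans ht.1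
        exact exp_le_one_iff.2 (by nlinarith)
    _ = f * x := by simp; ring

lemma integral_mul_exp_prod_expMeasure {lam mu β : ℝ} (f : ℝ)
    (hlam : 0 < lam) (hmu : 0 < mu) (hβ : 0 ≤ β)
    (hint : Integrable (fun p : ℝ × ℝ => if p.1 < p.2 then f * p.1 * exp (-β * p.1) else 0)
      ((expMeasure mu).prod (expMeasure lam))) :
    ∫ p : ℝ × ℝ, (if p.1 < p.2 then f * p.1 * exp (-β * p.1) else 0)
      ∂((expMeasure mu).prod (expMeasure lam)) = f * mu / (lam + mu + β) ^ 2 := by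
  have := isProbabilityMeasure_expMeasure hlam
  have := isProbabilityMeasure_expMeasure hmu
  have hinner : ∀ x : ℝ, ∫ y, (if x < y then f * x * exp (-β * x) else 0) ∂expMeasure lam
      = (expMeasure lam).real (Set.Ioi x) * (f * x * exp (-β * x)) := fun x =>
    integral_indicator_const (f * x * exp (-β * x)) (measurableSet_Ioi (a := x))
  have hs : 0 < lam + mu + β := by positivity
  have hG := integral_rpow_mul_exp_neg_mul_Ioi (a := 2) (by norm_num) hs
  have hΓ : Gamma 2 = 1 := by simp
  rw [hΓ, mul_one, rpow_two] at hG
  rw [integral_prod _ hint]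
  simp only [hinner]
  rw [integral_expMeasure hmu]
  calc _ = ∫ x in Set.Ioi (0 : ℝ), f * mu * (x ^ ((2 : ℝ) - 1) * exp (-((lam + mu + β) * x))) := by
        refine setIntegral_congr_fun measurableSet_Ioi fun x hx => ?_
        have hexp : exp (-((lam + mu + β) * x))
            = exp (-(mu * x)) * exp (-(lam * x)) * exp (-β * x) := by
          rw [← exp_add, ← exp_add]; ring_nf
        have hpow : x ^ ((2 : ℝ) - 1) = x := by norm_num
        simp only [measureReal_expMeasure_Ioi hlam (le_of_lt hx), hexp, hpow]
        ring
    _ = _ := by rw [integral_const_mul, hG]; field_simp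

/-- Quantitative content of the paper's Lemma 4: if `X ~ Exp(μ)` and `Y ~ Exp(λ)`
are independent, then `E[(∫_{(1-f)X}^{X} e^{-βt} dt)·1_{X<Y}] ≥ f·μ/(λ+μ+β)² > 0`. -/
theorem coupling_gain_lower_bound (lam mu β f : ℝ)
    (hlam : 0 < lam) (hmu : 0 < mu) (hβ : 0 ≤ β) (hf0 : 0 < f) (hf1 : f ≤ 1)
    {Ω : Type} [MeasureSpace Ω] [IsProbabilityMeasure (ℙ : Measure Ω)]
    (X Y : Ω → ℝ) (hX : Measurable X) (hY : Measurable Y)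
    (hXY : IndepFun X Y ℙ)
    (hlawX : Measure.map X ℙ = expMeasure mu)
    (hlawY : Measure.map Y ℙ = expMeasure lam) :
    (∫ ω, (if X ω < Y ω then ∫ t in ((1 - f) * X ω)..(X ω), exp (-β * t) else 0))
      ≥ f * mu / (lam + mu + β) ^ 2 ∧
    0 < ∫ ω, (if X ω < Y ω then ∫ t in ((1 - f) * X ω)..(X ω), exp (-β * t) else 0) := by
  have := isProbabilityMeasure_expMeasure hlam
  have := isProbabilityMeasure_expMeasure hmu
  set ν := (expMeasure mu).prod (expMeasure lam) with hν
  set G : ℝ × ℝ → ℝ := fun p =>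
    if p.1 < p.2 then ∫ t in ((1 - f) * p.1)..p.1, exp (-β * t) else 0 with hG
  set H : ℝ × ℝ → ℝ := fun p => if p.1 < p.2 then f * p.1 * exp (-β * p.1) else 0 with hH
  have hlt : MeasurableSet {p : ℝ × ℝ | p.1 < p.2} :=
    measurableSet_lt measurable_fst measurable_snd
  have hGm : Measurable G := Measurable.ite hlt
    ((continuous_integral_exp_window β f).measurable.comp measurable_fst) measurable_const
  have hHm : Measurable H := Measurable.ite hlt (by fun_prop) measurable_const
  have hmap : Measure.map (fun ω => (X ω, Y ω)) ℙ = ν := by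
    rw [hXY.map_prod_eq_prod_map_map hX.aemeasurable hY.aemeasurable, hlawX, hlawY]
  have hpos : ∀ᵐ p ∂ν, 0 < p.1 :=
    Measure.quasiMeasurePreserving_fst.ae (ae_expMeasure_pos mu)
  have hdom : Integrable (fun p : ℝ × ℝ => f * p.1) ν :=
    ((integrable_id_expMeasure hmu).comp_fst _).const_mul f
  have hbound : ∀ᵐ p ∂ν, 0 ≤ H p ∧ H p ≤ G p ∧ G p ≤ f * p.1 := by
    filter_upwards [hpos] with p hp
    by_cases h : p.1 < p.2
    · simp only [hG, hH, if_pos h]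
      exact ⟨by positivity, le_integral_exp_window hβ hf0.le hp.le,
        integral_exp_window_le hβ hf0.le hf1 hp.le⟩
    · simp only [hG, hH, if_neg h]
      exact ⟨le_rfl, le_rfl, by positivity⟩
  have hGi : Integrable G ν := hdom.mono' hGm.aestronglyMeasurable <| by
    filter_upwards [hbound] with p ⟨h0, h1, h2⟩
    rwa [norm_eq_abs, abs_of_nonneg (h0.trans h1)]
  have hHi : Integrable H ν := hdom.mono' hHm.aestronglyMeasurable <| by
    filter_upwards [hbound] with p ⟨h0, h1, h2⟩
    rw [norm_eq_abs, abs_of_nonneg h0]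
    exact h1.trans h2
  have hE : ∫ ω, (if X ω < Y ω then ∫ t in ((1 - f) * X ω)..(X ω), exp (-β * t) else 0)
      = ∫ p, G p ∂ν := by
    rw [← hmap, integral_map (hX.prodMk hY).aemeasurable hGm.aestronglyMeasurable]
  have hge : f * mu / (lam + mu + β) ^ 2 ≤ ∫ p, G p ∂ν := by
    rw [← integral_mul_exp_prod_expMeasure f hlam hmu hβ hHi]
    exact integral_mono_ae hHi hGi (hbound.mono fun p hp => hp.2.1)
  rw [hE]
  exact ⟨hge, lt_of_lt_of_le (by positivity) hge⟩
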